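/- In Version B, if G is a nonempty position (a nonempty multiset of positive pile sizes), then the position obtained from G by adjoining two additional piles of size 1 has the same outcome class as G: it is a P-position if and only if G is a P-position. -/

import Mathlib

/-- Remove one token from a pile of size `p` in `G`: delete one copy of `p` and,
if `p ≠ 1`, add back a pile of size `p - 1`. -/
def takeOne (G : Multiset ℕ) (p : ℕ) : Multiset ℕ :=
  G.erase p + (if p = 1 then (0 : Multiset ℕ) else {p - 1})

/-- Legal moves of Version B: remove one token from one chosen pile, or remove
one token from every pile simultaneously (piles reaching size 0 are deleted). -/
inductive MoveB : Multiset ℕ → Multiset ℕ → Prop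
  | one {G : Multiset ℕ} {p : ℕ} (hp : p ∈ G) (h1 : 1 ≤ p) : MoveB G (takeOne G p)
  | all {G : Multiset ℕ} (hG : G ≠ 0) : MoveB G ((G.map (· - 1)).filter (· ≠ 0))

mutual
  /-- P-positions of Version B under normal play: every move leads to an N-position
  (in particular the empty position is a P-position).  Since every move strictly
  decreases the total number of tokens, this inductive definition agrees with the
  usual recursive definition of outcome classes. -/
  inductive PPosB : Multiset ℕ → Prop
    | mk : ∀ {G : Multiset ℕ}, (∀ H, MoveB G H → NPosB H) → PPosB G
  /-- N-positions of Version B under normal play: some move leads to a P-position. -/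
  inductive NPosB : Multiset ℕ → Prop
    | mk : ∀ {G H : Multiset ℕ}, MoveB G H → PPosB H → NPosB G
end

theorem takeOne_cons_self (G : Multiset ℕ) (p : ℕ) :
    takeOne (p ::ₘ G) p = G + (if p = 1 then (0 : Multiset ℕ) else {p - 1}) := by
  simp [takeOne]

theorem takeOne_cons_of_mem {G : Multiset ℕ} {p : ℕ} (a : ℕ) (hp : p ∈ G) :
    takeOne (a ::ₘ G) p = a ::ₘ takeOne G p := by
  simp [takeOne, Multiset.erase_cons_tail_of_mem hp]

theorem takeOne_eq_zero {G : Multiset ℕ} {p : ℕ} (hp : p ∈ G) (h : takeOne G p = 0) :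
    G = {1} := by
  obtain ⟨E, rfl⟩ := Multiset.exists_cons_of_mem hp
  rw [takeOne_cons_self] at h
  split_ifs at h <;> simp_all

theorem sum_add_card_removeAll (G : Multiset ℕ) :
    ((G.map (· - 1)).filter (· ≠ 0)).sum + ((G.map (· - 1)).filter (· ≠ 0)).card + G.card
      ≤ G.sum + G.card := by
  induction G using Multiset.induction_on with
  | empty => simp
  | cons a G ih =>
    rw [Multiset.map_cons, Multiset.filter_cons]
    split_ifs <;> simp <;> simp at ih <;> omega

/-- Every move decreases the number of tokens plus the number of piles. -/
theorem MoveB.sum_add_card_lt {G H : Multiset ℕ} (h : MoveB G H) :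
    H.sum + H.card < G.sum + G.card := by
  cases h with
  | @one p hp h1 =>
    obtain ⟨E, rfl⟩ := Multiset.exists_cons_of_mem hp
    rw [takeOne_cons_self]
    split_ifs <;> simp <;> omega
  | all hG =>
    have := sum_add_card_removeAll G
    have := Multiset.card_pos.mpr hG
    omega

theorem PPosB.not_nPosB {G : Multiset ℕ} (h : PPosB G) : ¬ NPosB G := by
  refine PPosB.rec (motive_1 := fun G _ => ¬ NPosB G) (motive_2 := fun G _ => ¬ PPosB G)
    ?_ ?_ h
  · rintro G _ ih ⟨hm, hP⟩
    exact ih _ hm hP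
  · rintro G H hm _ ih ⟨hG⟩
    exact ih (hG H hm)

theorem pPosB_or_nPosB (G : Multiset ℕ) : PPosB G ∨ NPosB G := by
  induction hn : G.sum + G.card using Nat.strong_induction_on generalizing G with
  | _ n ih =>
    by_cases h : ∃ H, MoveB G H ∧ PPosB H
    · obtain ⟨H, hm, hP⟩ := h
      exact .inr ⟨hm, hP⟩
    · push Not at h
      refine .inl ⟨fun H hm => (ih _ (hn ▸ hm.sum_add_card_lt) H rfl).resolve_left (h H hm)⟩

theorem nPosB_of_moveB_zero {G : Multiset ℕ} (h : MoveB G 0) : NPosB G := by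
  refine ⟨h, ⟨fun H hm => ?_⟩⟩
  have := hm.sum_add_card_lt
  simp at this

theorem moveB_singleton_one : MoveB {1} 0 := by
  simpa [Multiset.filter_singleton] using MoveB.all (G := {1}) (by simp)

theorem moveB_one_cons_one_cons_all {G : Multiset ℕ} :
    MoveB (1 ::ₘ 1 ::ₘ G) ((G.map (· - 1)).filter (· ≠ 0)) := by
  simpa using MoveB.all (G := 1 ::ₘ 1 ::ₘ G) (by simp)

theorem moveB_one_cons (G : Multiset ℕ) : MoveB (1 ::ₘ G) G := by
  simpa [takeOne_cons_self] using MoveB.one (Multiset.mem_cons_self 1 G) le_rfl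

/-- The options of a position with two extra piles of size `1`. -/
theorem MoveB.of_one_cons_one_cons {G H : Multiset ℕ} (h : MoveB (1 ::ₘ 1 ::ₘ G) H) :
    H = 1 ::ₘ G ∨ H = (G.map (· - 1)).filter (· ≠ 0) ∨
      ∃ p ∈ G, 1 ≤ p ∧ H = 1 ::ₘ 1 ::ₘ takeOne G p := by
  cases h with
  | @one p hp h1 =>
    by_cases hp1 : p = 1
    · subst hp1
      simp [takeOne_cons_self]
    · have hpG : p ∈ G := by simpa [hp1] using hp
      refine .inr (.inr ⟨p, hpG, h1, ?_⟩)
      rw [takeOne_cons_of_mem _ (Multiset.mem_cons_of_mem hpG), takeOne_cons_of_mem _ hpG]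
  | all hG => simp

theorem add_two_ones_preserves_outcome :
    (∀ {G : Multiset ℕ}, PPosB G → G ≠ 0 → PPosB (1 ::ₘ 1 ::ₘ G)) ∧
      ∀ {G : Multiset ℕ}, NPosB G → G ≠ 0 → NPosB (1 ::ₘ 1 ::ₘ G) := by
  have hP : ∀ G : Multiset ℕ, (hG : ∀ H, MoveB G H → NPosB H) →
      (∀ H, MoveB G H → H ≠ 0 → NPosB (1 ::ₘ 1 ::ₘ H)) →
      G ≠ 0 → PPosB (1 ::ₘ 1 ::ₘ G) := by
    refine fun G hG ih hne => ⟨fun H hm => ?_⟩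
    rcases hm.of_one_cons_one_cons with rfl | rfl | ⟨p, hp, h1, rfl⟩
    · exact ⟨moveB_one_cons G, ⟨hG⟩⟩
    · exact hG _ (.all hne)
    · refine ih _ (.one hp h1) fun h0 => ?_
      obtain rfl := takeOne_eq_zero hp h0
      exact PPosB.not_nPosB ⟨hG⟩ (nPosB_of_moveB_zero moveB_singleton_one)
  have hN : ∀ G H : Multiset ℕ, MoveB G H → PPosB H →
      (H ≠ 0 → PPosB (1 ::ₘ 1 ::ₘ H)) → G ≠ 0 → NPosB (1 ::ₘ 1 ::ₘ G) := by
    intro G H hm hH ih hne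
    cases hm with
    | @one p hp h1 =>
      by_cases h0 : takeOne G p = 0
      · obtain rfl := takeOne_eq_zero hp h0
        exact nPosB_of_moveB_zero (by
          simpa [Multiset.filter_singleton] using moveB_one_cons_one_cons_all (G := {1}))
      · refine ⟨?_, ih h0⟩
        rw [← takeOne_cons_of_mem 1 hp, ← takeOne_cons_of_mem 1 (Multiset.mem_cons_of_mem hp)]
        exact .one (by simp [hp]) h1
    | all => exact ⟨moveB_one_cons_one_cons_all, hH⟩
  exact ⟨fun h => PPosB.rec (motive_1 := fun G _ => G ≠ 0 → PPosB (1 ::ₘ 1 ::ₘ G))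
      (motive_2 := fun G _ => G ≠ 0 → NPosB (1 ::ₘ 1 ::ₘ G))
      (fun {G} hG ih => hP G hG ih) (fun {G H} hm hH ih => hN G H hm hH ih) h,
    fun h => NPosB.rec (motive_1 := fun G _ => G ≠ 0 → PPosB (1 ::ₘ 1 ::ₘ G))
      (motive_2 := fun G _ => G ≠ 0 → NPosB (1 ::ₘ 1 ::ₘ G))
      (fun {G} hG ih => hP G hG ih) (fun {G H} hm hH ih => hN G H hm hH ih) h⟩

/-- In Version B, adjoining two piles of size 1 to a nonempty position does not
change its outcome class. -/
theorem versionB_add_two_ones (G : Multiset ℕ) (hG : 0 ∉ G) (hne : G ≠ 0) :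
    PPosB (1 ::ₘ 1 ::ₘ G) ↔ PPosB G := by
  refine ⟨fun h => (pPosB_or_nPosB G).resolve_right fun hN => ?_,
    fun h => add_two_ones_preserves_outcome.1 h hne⟩
  exact h.not_nPosB (add_two_ones_preserves_outcome.2 hN hne)
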